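/- The number of knot (4,6)-mosaics is D_{4,6} = 1144526. -/

import Mathlib

/-- The eleven mosaic tiles `T₀, …, T₁₀`. -/
inductive Tile : Type
  | T0 | T1 | T2 | T3 | T4 | T5 | T6 | T7 | T8 | T9 | T10
  deriving DecidableEq

namespace Tile

/-- Whether the top edge of a tile carries a connection point.
`T0` has no connection points; `T1,…,T6` realize the six unordered pairs of edges
(`T1`: bottom–left, `T2`: bottom–right, `T3`: top–right, `T4`: top–left,
`T5`: left–right, `T6`: top–bottom); `T7,…,T10` have all four. -/
def top : Tile → Bool
  | .T3 | .T4 | .T6 | .T7 | .T8 | .T9 | .T10 => true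
  | _ => false

/-- Whether the bottom edge of a tile carries a connection point. -/
def bottom : Tile → Bool
  | .T1 | .T2 | .T6 | .T7 | .T8 | .T9 | .T10 => true
  | _ => false

/-- Whether the left edge of a tile carries a connection point. -/
def left : Tile → Bool
  | .T1 | .T4 | .T5 | .T7 | .T8 | .T9 | .T10 => true
  | _ => false

/-- Whether the right edge of a tile carries a connection point. -/
def right : Tile → Bool
  | .T2 | .T3 | .T5 | .T7 | .T8 | .T9 | .T10 => true
  | _ => false

end Tile

/-- An `(m,n)`-mosaic `M : Fin m → Fin n → Tile` (rows indexed top-to-bottom,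
columns left-to-right) is suitably connected if any pair of contiguous tiles
have or do not have connection points simultaneously on their common edge. -/
def SuitablyConnected {m n : ℕ} (M : Fin m → Fin n → Tile) : Prop :=
  (∀ (i : Fin m) (j : Fin n) (h : (j : ℕ) + 1 < n),
    (M i j).right = (M i ⟨(j : ℕ) + 1, h⟩).left) ∧
  (∀ (i : Fin m) (j : Fin n) (h : (i : ℕ) + 1 < m),
    (M i j).bottom = (M ⟨(i : ℕ) + 1, h⟩ j).top)

/-- None of the boundary edges of the mosaic carries a connection point. -/
def BoundaryFree {m n : ℕ} (M : Fin m → Fin n → Tile) : Prop :=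
  ∀ (i : Fin m) (j : Fin n),
    ((i : ℕ) = 0 → (M i j).top = false) ∧
    ((i : ℕ) = m - 1 → (M i j).bottom = false) ∧
    ((j : ℕ) = 0 → (M i j).left = false) ∧
    ((j : ℕ) = n - 1 → (M i j).right = false)

/-- A knot `(m,n)`-mosaic is a suitably connected mosaic none of whose boundary
edges has a connection point. -/
def IsKnotMosaic {m n : ℕ} (M : Fin m → Fin n → Tile) : Prop :=
  SuitablyConnected M ∧ BoundaryFree M

/-- `D m n`, the number of knot `(m,n)`-mosaics. -/
noncomputable def knotMosaicCount (m n : ℕ) : ℕ :=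
  Nat.card {M : Fin m → Fin n → Tile // IsKnotMosaic M}

/-- `|Q^{(p,q)}|`, the number of `(p,q)`-quasimosaics (suitably connected
`(p,q)`-mosaics, with connection points allowed on boundary edges). -/
noncomputable def quasimosaicCount (p q : ℕ) : ℕ :=
  Nat.card {M : Fin p → Fin q → Tile // SuitablyConnected M}

instance : Fintype Tile where
  elems := {.T0, .T1, .T2, .T3, .T4, .T5, .T6, .T7, .T8, .T9, .T10}
  complete x := by cases x <;> decide

section Chain

variable {α σ : Type*}

/-- `f 0, …, f (n - 1)` is a chain from the state `s` to the state `t`: its `k`-th letter satisfies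
`P k`, and the output state of each letter is the input state of the next one. -/
def IsLetterChain (inp out : α → σ) : {n : ℕ} → (Fin n → α → Prop) → (Fin n → α) → σ → σ → Prop
  | 0, _, _, s, t => s = t
  | _ + 1, P, f, s, t =>
    (P 0 (f 0) ∧ inp (f 0) = s) ∧
      IsLetterChain inp out (fun k => P k.succ) (Fin.tail f) (out (f 0)) t

theorem isLetterChain_succ_iff (inp out : α → σ) {n : ℕ} (P : Fin (n + 1) → α → Prop)
    (f : Fin (n + 1) → α) (s t : σ) :
    IsLetterChain inp out P f s t ↔ (∀ k, P k (f k)) ∧ inp (f 0) = s ∧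
      (∀ k : Fin n, out (f k.castSucc) = inp (f k.succ)) ∧ out (f (Fin.last n)) = t := by
  induction n generalizing s with
  | zero => simp [IsLetterChain, Fin.forall_fin_succ, and_assoc]
  | succ n ih =>
    rw [IsLetterChain, ih, Fin.forall_fin_succ (P := fun k => P k (f k)),
      Fin.forall_fin_succ (P := fun k : Fin (n + 1) => out (f k.castSucc) = inp (f k.succ))]
    simp only [Fin.tail, Fin.succ_last, Fin.castSucc_zero, Fin.castSucc_succ]
    tauto

/-- Removing the first letter of a chain, classified by the state which follows that letter. -/
def isLetterChainSuccEquiv (inp out : α → σ) {n : ℕ} (P : Fin (n + 1) → α → Prop) (s t : σ) :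
    {f : Fin (n + 1) → α // IsLetterChain inp out P f s t} ≃
      Σ u : σ, {a : α // P 0 a ∧ inp a = s ∧ out a = u} ×
        {f : Fin n → α // IsLetterChain inp out (fun k => P k.succ) f u t} where
  toFun f := ⟨out (f.1 0), ⟨f.1 0, f.2.1.1, f.2.1.2, rfl⟩, ⟨Fin.tail f.1, f.2.2⟩⟩
  invFun x := ⟨Fin.cons x.2.1.1 x.2.2.1, ⟨x.2.1.2.1, x.2.1.2.2.1⟩, by
    simpa [x.2.1.2.2.2] using x.2.2.2⟩
  left_inv f := Subtype.ext (Fin.cons_self_tail f.1)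
  right_inv := by
    rintro ⟨u, ⟨a, h, h', rfl⟩, f, hf⟩
    rfl

theorem card_isLetterChain_succ [Finite α] [Fintype σ] (inp out : α → σ) {n : ℕ}
    (P : Fin (n + 1) → α → Prop) (s t : σ) :
    Nat.card {f : Fin (n + 1) → α // IsLetterChain inp out P f s t} =
      ∑ u : σ, Nat.card {a : α // P 0 a ∧ inp a = s ∧ out a = u} *
        Nat.card {f : Fin n → α // IsLetterChain inp out (fun k => P k.succ) f u t} := by
  rw [Nat.card_congr (isLetterChainSuccEquiv inp out P s t), Nat.card_sigma]
  simp only [Nat.card_prod]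

theorem card_isLetterChain_zero [DecidableEq σ] (inp out : α → σ) (P : Fin 0 → α → Prop) (s t : σ) :
    Nat.card {f : Fin 0 → α // IsLetterChain inp out P f s t} = if s = t then 1 else 0 := by
  split_ifs with h <;> simp [IsLetterChain, h]

end Chain

/-- A knot mosaic is a chain of columns, each of which is a chain of tiles. -/
theorem isKnotMosaic_iff_isLetterChain {m n : ℕ} (M : Fin (m + 1) → Fin (n + 1) → Tile) :
    IsKnotMosaic M ↔ IsLetterChain (fun c k => (c k).left) (fun c k => (c k).right)
      (fun _ c => IsLetterChain Tile.top Tile.bottom (fun _ _ => True) c false false)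
      (fun j i => M i j) (fun _ => false) (fun _ => false) := by
  simp only [isLetterChain_succ_iff, funext_iff, implies_true, true_and]
  constructor
  · rintro ⟨⟨hr, hb⟩, h⟩
    refine ⟨fun j => ⟨(h 0 j).1 rfl, fun i => hb i.castSucc j (by simp),
      (h (Fin.last m) j).2.1 (by simp)⟩, fun i => (h i 0).2.2.1 rfl,
      fun j i => hr i j.castSucc (by simp), fun i => (h i (Fin.last n)).2.2.2 (by simp)⟩
  · rintro ⟨hc, hl, hlr, hr⟩
    refine ⟨⟨fun i j h => hlr ⟨j, by omega⟩ i, fun i j h => (hc j).2.1 ⟨i, by omega⟩⟩,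
      fun i j => ⟨fun h => ?_, fun h => ?_, fun h => ?_, fun h => ?_⟩⟩
    · rw [show i = 0 from Fin.ext h]; exact (hc j).1
    · rw [show i = Fin.last m from Fin.ext h]; exact (hc j).2.2
    · rw [show j = 0 from Fin.ext h]; exact hl i
    · rw [show j = Fin.last n from Fin.ext h]; exact hr i

theorem card_tile (l r t b : Bool) :
    Nat.card {a : Tile // (a.left = l ∧ a.right = r) ∧ a.top = t ∧ a.bottom = b} =
      if b = (t ^^ l ^^ r) then (if t && l && r then 4 else 1) else 0 := by
  rw [Nat.card_eq_fintype_card]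
  revert l r t b
  decide

/-- The number of suitably connected columns with prescribed connection points `l` on the left,
`r` on the right, `t` on the top, and none on the bottom. -/
def columnCount : {m : ℕ} → (Fin m → Bool) → (Fin m → Bool) → Bool → ℕ
  | 0, _, _, t => if t then 0 else 1
  | _ + 1, l, r, t => (if t && l 0 && r 0 then 4 else 1) *
      columnCount (Fin.tail l) (Fin.tail r) (t ^^ l 0 ^^ r 0)

theorem card_column {m : ℕ} (l r : Fin m → Bool) (t : Bool) :
    Nat.card {c : Fin m → Tile // IsLetterChain Tile.top Tile.bottom
      (fun k a => a.left = l k ∧ a.right = r k) c t false} = columnCount l r t := by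
  induction m generalizing t with
  | zero => rw [card_isLetterChain_zero]; cases t <;> rfl
  | succ m ih =>
    rw [card_isLetterChain_succ, Finset.sum_eq_single (t ^^ l 0 ^^ r 0)]
    · rw [card_tile, if_pos rfl]
      exact congrArg _ (ih (Fin.tail l) (Fin.tail r) _)
    · intro b _ hb
      rw [card_tile, if_neg hb, zero_mul]
    · simp

/-- One step of the transfer matrix method, adding a column on the left. -/
def transfer {m : ℕ} (v : (Fin m → Bool) → ℕ) (l : Fin m → Bool) : ℕ :=
  ∑ r : Fin m → Bool, columnCount l r false * v r

theorem card_isLetterChain_column {m n : ℕ} (l : Fin (m + 1) → Bool) :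
    Nat.card {f : Fin n → Fin (m + 1) → Tile //
      IsLetterChain (fun c k => (c k).left) (fun c k => (c k).right)
        (fun _ c => IsLetterChain Tile.top Tile.bottom (fun _ _ => True) c false false)
        f l (fun _ => false)} =
      transfer^[n] (fun l => if l = fun _ => false then 1 else 0) l := by
  induction n generalizing l with
  | zero => rw [card_isLetterChain_zero]; rfl
  | succ n ih =>
    rw [card_isLetterChain_succ, Function.iterate_succ_apply', transfer]
    refine Finset.sum_congr rfl fun r _ => ?_
    rw [ih, ← card_column]
    congr 1
    refine Nat.card_congr (Equiv.subtypeEquivRight fun c => ?_)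
    simp only [isLetterChain_succ_iff, funext_iff, forall_and]
    tauto

theorem knotMosaicCount_succ_succ (m n : ℕ) :
    knotMosaicCount (m + 1) (n + 1) =
      transfer^[n + 1] (fun l : Fin (m + 1) → Bool => if l = fun _ => false then 1 else 0)
        (fun _ => false) := by
  rw [← card_isLetterChain_column]
  exact Nat.card_congr ((Equiv.piComm _).subtypeEquiv isKnotMosaic_iff_isLetterChain)

/-- The number of knot `(4,6)`-mosaics is `D_{4,6} = 1144526`. -/
theorem knotMosaicCount_four_six : knotMosaicCount 4 6 = 1144526 := by
  rw [knotMosaicCount_succ_succ]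
  decide +kernel
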